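/- Let k ≥ 1 and let ν be a probability measure on (0,∞)^k which is invariant for Q, i.e. νQ = ν. Then the density f_ν is a fixed point of the gaps operator of iterated Brownian motion: for every x ∈ (0,∞)^k, ∫_{(0,∞)^k} f_ν(g) Ψ_g(x) dg = f_ν(x). -/

import Mathlib

open MeasureTheory ProbabilityTheory Real Finset

noncomputable section

/-- Density of the centred Gaussian law with variance `g`. -/
def Phi (g y : ℝ) : ℝ := (Real.sqrt (2 * Real.pi * g))⁻¹ * Real.exp (-(y ^ 2) / (2 * g))

/-- Partial sums: `xbar x j = x 0 + ⋯ + x (j-1)` (i.e. `x̄_j`), with `x̄_0 = 0`. -/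
def xbar {k : ℕ} (x : Fin k → ℝ) (j : Fin (k + 1)) : ℝ :=
  ∑ i : Fin k, if (i : ℕ) < (j : ℕ) then x i else 0

/-- The density `Ψ_g` of the gaps sequence of iterated Brownian motion. -/
def Psi {k : ℕ} (g x : Fin k → ℝ) : ℝ :=
  ∑ τ : Equiv.Perm (Fin (k + 1)), ∏ i : Fin k,
    Phi (g i) (xbar x (τ i.succ) - xbar x (τ i.castSucc))

/-- The gaps sequence of a `(k+1)`-tuple of reals. -/
def gaps {k : ℕ} (ℓ : Fin (k + 1) → ℝ) : Fin k → ℝ :=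
  fun i => ℓ (Tuple.sort ℓ i.succ) - ℓ (Tuple.sort ℓ i.castSucc)

/-- `E_{τ,i}`: the set of `j ∈ {1,…,k}` with `min(τ(j-1),τ(j)) < i ≤ max(τ(j-1),τ(j))`
(index `j : Fin k` represents `j+1`, `i : Fin k` represents `i+1`). -/
def Eset {k : ℕ} (τ : Equiv.Perm (Fin (k + 1))) (i : Fin k) : Finset (Fin k) :=
  Finset.univ.filter (fun j : Fin k =>
    min ((τ j.castSucc : Fin (k + 1)) : ℕ) ((τ j.succ : Fin (k + 1)) : ℕ) < (i : ℕ) + 1 ∧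
      (i : ℕ) + 1 ≤ max ((τ j.castSucc : Fin (k + 1)) : ℕ) ((τ j.succ : Fin (k + 1)) : ℕ))

/-- `F_{τ,i}(λ) = Σ_{j ∈ E_{τ,i}} √(2 λ_j)`. -/
def F {k : ℕ} (τ : Equiv.Perm (Fin (k + 1))) (i : Fin k) (l : Fin k → ℝ) : ℝ :=
  ∑ j ∈ Eset τ i, Real.sqrt (2 * l j)

/-- `w_τ(λ) = 2^{-k} Π_i √(2 λ_i) / F_{τ,i}(λ)`. -/
def w {k : ℕ} (τ : Equiv.Perm (Fin (k + 1))) (l : Fin k → ℝ) : ℝ :=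
  (2 : ℝ)⁻¹ ^ k * ∏ i : Fin k, Real.sqrt (2 * l i) / F τ i l

/-- The mixture of products of exponential densities with parameter law `ν`:
`f_ν(x) = ∫ Π_i λ_i e^{−λ_i x_i} dν(λ)`. -/
def fmix {k : ℕ} (ν : Measure (Fin k → ℝ)) (x : Fin k → ℝ) : ℝ :=
  ∫ l, ∏ i : Fin k, l i * Real.exp (-(l i * x i)) ∂ν

/-- The Markov kernel `Q(λ, ·) = Σ_{τ ∈ S(0..k)} w_τ(λ) δ_{F_τ(λ)}` at the parameter
level; `ν.bind Qker` is the measure `νQ : A ↦ ∫ Σ_τ w_τ(λ) 1_{F_τ(λ) ∈ A} dν(λ)`. -/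
def Qker {k : ℕ} (l : Fin k → ℝ) : Measure (Fin k → ℝ) :=
  ∑ τ : Equiv.Perm (Fin (k + 1)),
    ENNReal.ofReal (w τ l) • Measure.dirac (fun i => F τ i l)

section

open Filter Topology

lemma hasDerivAt_integral_exp_neg_sq (s : ℝ) :
    HasDerivAt (fun s => ∫ u in (0 : ℝ)..s, Real.exp (-u ^ 2)) (Real.exp (-s ^ 2)) s :=
  (Continuous.integral_hasStrictDerivAt (by fun_prop) 0 s).hasDerivAt

lemma tendsto_integral_exp_neg_sq_atTop :
    Tendsto (fun s => ∫ u in (0 : ℝ)..s, Real.exp (-u ^ 2)) atTop (𝓝 (√π / 2)) := by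
  have h := intervalIntegral_tendsto_integral_Ioi (μ := volume) (f := fun u : ℝ => Real.exp (-1 * u ^ 2)) 0
    (integrable_exp_neg_mul_sq one_pos).integrableOn tendsto_id
  rw [integral_gaussian_Ioi] at h
  simpa using h

lemma tendsto_integral_exp_neg_sq_atBot :
    Tendsto (fun s => ∫ u in (0 : ℝ)..s, Real.exp (-u ^ 2)) atBot (𝓝 (-(√π / 2))) := by
  have h := (tendsto_integral_exp_neg_sq_atTop.comp tendsto_neg_atBot_atTop).neg
  refine h.congr fun s => ?_
  have := intervalIntegral.integral_comp_neg (a := 0) (b := s) (fun u : ℝ => Real.exp (-u ^ 2))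
  simp only [neg_sq, neg_zero] at this
  simp only [Function.comp_apply]
  rw [this, intervalIntegral.integral_symm, neg_neg]

/-- The Cauchy–Schlömilch (Glasser) integral in the variable `g = t ^ 2`. -/
lemma integral_exp_neg_add_inv {a b : ℝ} (ha : 0 < a) (hb : 0 ≤ b) :
    IntegrableOn (fun g => a * Real.exp (-(a ^ 2 * g) - b ^ 2 / g) / √g) (Set.Ioi 0) ∧
    ∫ g in Set.Ioi (0 : ℝ), a * Real.exp (-(a ^ 2 * g) - b ^ 2 / g) / √g =
      √π * Real.exp (-(2 * a * b)) := by
  set P : ℝ → ℝ := fun s => ∫ u in (0 : ℝ)..s, Real.exp (-u ^ 2) with hP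
  set A : ℝ → ℝ := fun g => Real.exp (2 * a * b) * P (a * √g + b / √g) +
    Real.exp (-(2 * a * b)) * P (a * √g - b / √g) with hA
  set L₀ : ℝ := Real.exp (2 * a * b) * (√π / 2) + Real.exp (-(2 * a * b)) * (-(√π / 2)) with hL₀
  set L : ℝ := Real.exp (2 * a * b) * (√π / 2) + Real.exp (-(2 * a * b)) * (√π / 2) with hL
  have hs0 : Tendsto (fun g : ℝ => √g) (𝓝[>] 0) (𝓝[>] 0) := by
    refine tendsto_nhdsWithin_iff.2 ⟨?_, ?_⟩
    · simpa using (Real.continuous_sqrt.tendsto 0).mono_left nhdsWithin_le_nhds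
    · filter_upwards [self_mem_nhdsWithin] with g hg using Real.sqrt_pos.2 hg
  have hPc : Continuous P :=
    continuous_iff_continuousAt.2 fun s => (hasDerivAt_integral_exp_neg_sq s).continuousAt
  have hzero : Tendsto A (𝓝[>] 0) (𝓝 L₀) := by
    have hm : Tendsto (fun g : ℝ => a * √g) (𝓝[>] 0) (𝓝 0) := by
      simpa using (hs0.mono_right nhdsWithin_le_nhds).const_mul a
    rcases hb.eq_or_lt with rfl | hb
    · have : L₀ = Real.exp (2 * a * 0) * P 0 + Real.exp (-(2 * a * 0)) * P 0 := by
        simp [hL₀, hP]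
      rw [this]
      have hP0 := (hPc.tendsto 0).comp hm
      simpa [hA, Function.comp_def] using hP0.add hP0
    · have hd : Tendsto (fun g : ℝ => b / √g) (𝓝[>] 0) atTop := by
        simpa [div_eq_mul_inv] using
          Tendsto.const_mul_atTop hb (tendsto_inv_nhdsGT_zero.comp hs0)
      refine Tendsto.add (Tendsto.const_mul _ ?_) (Tendsto.const_mul _ ?_)
      · exact tendsto_integral_exp_neg_sq_atTop.comp (hm.add_atTop hd)
      · refine tendsto_integral_exp_neg_sq_atBot.comp ?_
        simpa [sub_eq_add_neg] using hm.add_atBot (tendsto_neg_atTop_atBot.comp hd)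
  have htop : Tendsto A atTop (𝓝 L) := by
    have hm : Tendsto (fun g : ℝ => a * √g) atTop atTop :=
      Tendsto.const_mul_atTop ha tendsto_sqrt_atTop
    have hd : Tendsto (fun g : ℝ => b / √g) atTop (𝓝 0) :=
      tendsto_const_nhds.div_atTop tendsto_sqrt_atTop
    refine Tendsto.add (Tendsto.const_mul _ ?_) (Tendsto.const_mul _ ?_)
    · exact tendsto_integral_exp_neg_sq_atTop.comp (hm.atTop_add hd)
    · refine tendsto_integral_exp_neg_sq_atTop.comp ?_
      simpa [sub_eq_add_neg] using hm.atTop_add hd.neg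
  have hderiv : ∀ g ∈ Set.Ioi (0 : ℝ),
      HasDerivAt A (a * Real.exp (-(a ^ 2 * g) - b ^ 2 / g) / √g) g := by
    intro g hg
    have hg : 0 < g := hg
    have hsg : 0 < √g := Real.sqrt_pos.2 hg
    have hsq : √g ^ 2 = g := Real.sq_sqrt hg.le
    have h1 : HasDerivAt (fun g : ℝ => √g) (1 / (2 * √g)) g := Real.hasDerivAt_sqrt hg.ne'
    have h2 := h1.const_mul a
    have h3 := (h1.inv hsg.ne').const_mul b
    have hp := (hasDerivAt_integral_exp_neg_sq (a * √g + b / √g)).comp g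
      (by simpa [div_eq_mul_inv] using h2.add h3)
    have hq := (hasDerivAt_integral_exp_neg_sq (a * √g - b / √g)).comp g
      (by simpa [div_eq_mul_inv] using h2.sub h3)
    have hAd := (hp.const_mul (Real.exp (2 * a * b))).add
      (hq.const_mul (Real.exp (-(2 * a * b))))
    refine hAd.congr_deriv ?_
    have e1 : Real.exp (2 * a * b) * Real.exp (-(a * √g + b / √g) ^ 2) =
        Real.exp (-(a ^ 2 * g) - b ^ 2 / g) := by
      rw [← Real.exp_add]; congr 1; nth_rewrite 3 4 [← hsq]; field_simp; ring
    have e2 : Real.exp (-(2 * a * b)) * Real.exp (-(a * √g - b / √g) ^ 2) =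
        Real.exp (-(a ^ 2 * g) - b ^ 2 / g) := by
      rw [← Real.exp_add]; congr 1; nth_rewrite 3 4 [← hsq]; field_simp; ring
    rw [← mul_assoc (Real.exp (2 * a * b)), ← mul_assoc (Real.exp (-(2 * a * b))), e1, e2, hsq]
    field_simp
    ring
  set B := Function.update A 0 L₀
  have hBA : ∀ g : ℝ, 0 < g → B =ᶠ[𝓝 g] A := fun g hg => by
    filter_upwards [lt_mem_nhds hg] with t ht
    exact Function.update_of_ne ht.ne' _ _
  have hBc : ContinuousWithinAt B (Set.Ici 0) 0 := by
    rw [continuousWithinAt_update_same]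
    simpa using hzero
  have hBd : ∀ g ∈ Set.Ioi (0 : ℝ),
      HasDerivAt B (a * Real.exp (-(a ^ 2 * g) - b ^ 2 / g) / √g) g := fun g hg =>
    (hderiv g hg).congr_of_eventuallyEq (hBA g hg)
  have hBt : Tendsto B atTop (𝓝 L) := htop.congr' (by
    filter_upwards [eventually_gt_atTop 0] with t ht
    exact (Function.update_of_ne ht.ne' _ _).symm)
  have hnn : ∀ g ∈ Set.Ioi (0 : ℝ), 0 ≤ a * Real.exp (-(a ^ 2 * g) - b ^ 2 / g) / √g :=
    fun g _ => by positivity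
  refine ⟨integrableOn_Ioi_deriv_of_nonneg hBc hBd hnn hBt, ?_⟩
  rw [integral_Ioi_of_hasDerivAt_of_nonneg hBc hBd hnn hBt]
  simp only [B, Function.update_self, hL, hL₀]
  ring

lemma integral_mul_exp_mul_Phi {c : ℝ} (hc : 0 < c) (y : ℝ) :
    IntegrableOn (fun g => c * Real.exp (-(c * g)) * Phi g y) (Set.Ioi 0) ∧
    ∫ g in Set.Ioi (0 : ℝ), c * Real.exp (-(c * g)) * Phi g y =
      2⁻¹ * √(2 * c) * Real.exp (-(√(2 * c) * |y|)) := by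
  have ha : 0 < √c := Real.sqrt_pos.2 hc
  have hb : 0 ≤ |y| / √2 := by positivity
  have hsc : √c ^ 2 = c := Real.sq_sqrt hc.le
  have hs2 : √2 ^ 2 = (2 : ℝ) := Real.sq_sqrt zero_le_two
  have h2 : 0 < √(2 : ℝ) := by positivity
  have hπ : 0 < √π := Real.sqrt_pos.2 Real.pi_pos
  obtain ⟨hi, he⟩ := integral_exp_neg_add_inv ha hb
  have hcongr : Set.EqOn (fun g => √c / (√2 * √π) * (√c *
      Real.exp (-(√c ^ 2 * g) - (|y| / √2) ^ 2 / g) / √g))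
      (fun g => c * Real.exp (-(c * g)) * Phi g y) (Set.Ioi 0) := by
    intro g hg
    have hg : 0 < g := hg
    have hsg : 0 < √g := Real.sqrt_pos.2 hg
    have e : Real.exp (-(c * g)) * Real.exp (-(y ^ 2) / (2 * g)) =
        Real.exp (-(√c ^ 2 * g) - (|y| / √2) ^ 2 / g) := by
      rw [← Real.exp_add, hsc, div_pow, hs2, sq_abs]
      congr 1
      field_simp
      ring
    simp only [Phi]
    rw [← e, Real.sqrt_mul (by positivity), Real.sqrt_mul zero_le_two]
    nth_rewrite 4 [← hsc]
    field_simp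
  refine ⟨IntegrableOn.congr_fun (hi.const_mul _) hcongr measurableSet_Ioi, ?_⟩
  rw [← setIntegral_congr_fun measurableSet_Ioi hcongr, integral_const_mul, he,
    Real.sqrt_mul zero_le_two]
  have e : 2 * √c * (|y| / √2) = √2 * √c * |y| := by
    nth_rewrite 1 [← hs2]
    field_simp
  rw [e]
  field_simp
  rw [hs2]

variable {k : ℕ}

lemma abs_xbar_sub_xbar {x : Fin k → ℝ} (hx : ∀ i, 0 < x i) (a b : Fin (k + 1)) :
    |xbar x b - xbar x a| =
      ∑ i : Fin k, if min (a : ℕ) b < i + 1 ∧ (i : ℕ) + 1 ≤ max (a : ℕ) b then x i else 0 := by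
  wlog hab : a ≤ b generalizing a b
  · rw [abs_sub_comm, this b a (le_of_not_ge hab), min_comm, max_comm]
  have hab' : (a : ℕ) ≤ b := hab
  have h : xbar x b - xbar x a =
      ∑ i : Fin k, if min (a : ℕ) b < i + 1 ∧ (i : ℕ) + 1 ≤ max (a : ℕ) b then x i else 0 := by
    rw [xbar, xbar, ← Finset.sum_sub_distrib]
    refine Finset.sum_congr rfl fun i _ => ?_
    rw [min_eq_left hab', max_eq_right hab']
    split_ifs <;> first | omega | simp
  rw [h, abs_of_nonneg]
  refine Finset.sum_nonneg fun i _ => ?_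
  split_ifs
  exacts [(hx i).le, le_rfl]

lemma Eset_nonempty (τ : Equiv.Perm (Fin (k + 1))) (i : Fin k) : (Eset τ i).Nonempty := by
  by_contra h
  have hj : ∀ j : Fin k, (τ j.castSucc : ℕ) ≤ i ↔ (τ j.succ : ℕ) ≤ i := by
    intro j
    have : j ∉ Eset τ i := fun hj => h ⟨j, hj⟩
    simp only [Eset, Finset.mem_filter, Finset.mem_univ, true_and] at this
    omega
  have hall : ∀ j : Fin (k + 1), (τ j : ℕ) ≤ i ↔ (τ 0 : ℕ) ≤ i := by
    intro j
    induction j using Fin.induction with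
    | zero => rfl
    | succ j ih => rw [← hj, ih]
  have h0 := hall (τ.symm 0)
  have h1 := hall (τ.symm (Fin.last k))
  have := i.isLt
  simp only [Equiv.apply_symm_apply, Fin.val_zero, Fin.val_last] at h0 h1
  omega

lemma F_pos (τ : Equiv.Perm (Fin (k + 1))) (i : Fin k) {l : Fin k → ℝ} (hl : ∀ i, 0 < l i) :
    0 < F τ i l :=
  Finset.sum_pos (fun j _ => Real.sqrt_pos.2 (mul_pos two_pos (hl j))) (Eset_nonempty τ i)

lemma w_nonneg (τ : Equiv.Perm (Fin (k + 1))) {l : Fin k → ℝ} (hl : ∀ i, 0 < l i) :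
    0 ≤ w τ l :=
  mul_nonneg (by positivity) (Finset.prod_nonneg fun i _ =>
    div_nonneg (Real.sqrt_nonneg _) (F_pos τ i hl).le)

lemma sum_sqrt_mul_abs_xbar_sub {x : Fin k → ℝ} (hx : ∀ i, 0 < x i)
    (τ : Equiv.Perm (Fin (k + 1))) (l : Fin k → ℝ) :
    ∑ j : Fin k, √(2 * l j) * |xbar x (τ j.succ) - xbar x (τ j.castSucc)| =
      ∑ i : Fin k, F τ i l * x i := by
  simp_rw [abs_xbar_sub_xbar hx, F, Eset, Finset.sum_filter, Finset.mul_sum, Finset.sum_mul]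
  rw [Finset.sum_comm]
  refine Finset.sum_congr rfl fun i _ => Finset.sum_congr rfl fun j _ => ?_
  split_ifs <;> simp

lemma prod_sqrt_mul_exp_eq {x l : Fin k → ℝ} (hx : ∀ i, 0 < x i) (hl : ∀ i, 0 < l i)
    (τ : Equiv.Perm (Fin (k + 1))) :
    ∏ j : Fin k, 2⁻¹ * √(2 * l j) *
        Real.exp (-(√(2 * l j) * |xbar x (τ j.succ) - xbar x (τ j.castSucc)|)) =
      w τ l * ∏ i : Fin k, F τ i l * Real.exp (-(F τ i l * x i)) := by
  simp_rw [Finset.prod_mul_distrib, ← Real.exp_sum, Finset.sum_neg_distrib,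
    sum_sqrt_mul_abs_xbar_sub hx, w, Finset.prod_div_distrib]
  have : ∏ i : Fin k, F τ i l ≠ 0 := Finset.prod_ne_zero_iff.2 fun i _ => (F_pos τ i hl).ne'
  simp only [Finset.prod_const, Finset.card_univ, Fintype.card_fin]
  field_simp

lemma Phi_nonneg (g y : ℝ) : 0 ≤ Phi g y := by unfold Phi; positivity

lemma Psi_nonneg (g x : Fin k → ℝ) : 0 ≤ Psi g x :=
  Finset.sum_nonneg fun _ _ => Finset.prod_nonneg fun _ _ => Phi_nonneg _ _

lemma setOf_forall_pos_eq_pi :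
    {g : Fin k → ℝ | ∀ i, 0 < g i} = Set.univ.pi fun _ => Set.Ioi 0 := by
  ext; simp

lemma measurableSet_setOf_forall_pos : MeasurableSet {g : Fin k → ℝ | ∀ i, 0 < g i} := by
  rw [setOf_forall_pos_eq_pi]
  exact MeasurableSet.univ_pi fun _ => measurableSet_Ioi

lemma prod_mul_exp_nonneg {l : Fin k → ℝ} (hl : ∀ i, 0 < l i) (x : Fin k → ℝ) :
    0 ≤ ∏ i : Fin k, l i * Real.exp (-(l i * x i)) :=
  Finset.prod_nonneg fun i _ => mul_nonneg (hl i).le (Real.exp_nonneg _)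

/-- The gaps operator maps a product of exponential densities to a finite mixture of such. -/
lemma lintegral_prod_exp_mul_Psi {x l : Fin k → ℝ} (hx : ∀ i, 0 < x i) (hl : ∀ i, 0 < l i) :
    ∫⁻ g in {g : Fin k → ℝ | ∀ i, 0 < g i},
        ENNReal.ofReal (∏ i : Fin k, l i * Real.exp (-(l i * g i))) * ENNReal.ofReal (Psi g x) =
      ∑ τ : Equiv.Perm (Fin (k + 1)), ENNReal.ofReal (w τ l) *
        ENNReal.ofReal (∏ i : Fin k, F τ i l * Real.exp (-(F τ i l * x i))) := by
  set y : Equiv.Perm (Fin (k + 1)) → Fin k → ℝ :=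
    fun τ i => xbar x (τ i.succ) - xbar x (τ i.castSucc) with hy
  have hprod : ∀ g : Fin k → ℝ,
      (∏ i : Fin k, l i * Real.exp (-(l i * g i))) * Psi g x =
        ∑ τ : Equiv.Perm (Fin (k + 1)),
          ∏ i : Fin k, l i * Real.exp (-(l i * g i)) * Phi (g i) (y τ i) := by
    intro g
    simp only [Psi, Finset.mul_sum, ← Finset.prod_mul_distrib, hy]
  have hint : ∀ τ : Equiv.Perm (Fin (k + 1)), Integrable (fun g : Fin k → ℝ =>
      ∏ i : Fin k, l i * Real.exp (-(l i * g i)) * Phi (g i) (y τ i))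
      (Measure.pi fun _ => volume.restrict (Set.Ioi 0)) := fun τ =>
    Integrable.fintype_prod (f := fun i g => l i * Real.exp (-(l i * g)) * Phi g (y τ i))
      fun i => (integral_mul_exp_mul_Phi (hl i) (y τ i)).1
  have hval : ∀ τ : Equiv.Perm (Fin (k + 1)), ∫ g : Fin k → ℝ,
      ∏ i : Fin k, l i * Real.exp (-(l i * g i)) * Phi (g i) (y τ i)
      ∂(Measure.pi fun _ => volume.restrict (Set.Ioi 0)) =
      w τ l * ∏ i : Fin k, F τ i l * Real.exp (-(F τ i l * x i)) := by
    intro τ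
    rw [integral_fintype_prod_eq_prod (fun i g => l i * Real.exp (-(l i * g)) * Phi g (y τ i)),
      ← prod_sqrt_mul_exp_eq hx hl τ]
    exact Finset.prod_congr rfl fun i _ => (integral_mul_exp_mul_Phi (hl i) (y τ i)).2
  rw [setOf_forall_pos_eq_pi, volume_pi, Measure.restrict_pi_pi]
  simp_rw [← ENNReal.ofReal_mul (prod_mul_exp_nonneg hl _), hprod]
  rw [← ofReal_integral_eq_lintegral_ofReal (integrable_finsetSum _ fun τ _ => hint τ)
      (Filter.Eventually.of_forall fun g => by
        simp only [← hprod]; exact mul_nonneg (prod_mul_exp_nonneg hl _) (Psi_nonneg _ _)),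
    integral_finsetSum _ fun τ _ => hint τ]
  simp_rw [hval]
  rw [ENNReal.ofReal_sum_of_nonneg fun τ _ => mul_nonneg (w_nonneg τ hl)
    (prod_mul_exp_nonneg (fun i => F_pos τ i hl) x)]
  exact Finset.sum_congr rfl fun τ _ => ENNReal.ofReal_mul (w_nonneg τ hl)

@[fun_prop]
lemma measurable_F (τ : Equiv.Perm (Fin (k + 1))) (i : Fin k) : Measurable (F τ i) := by
  unfold F; fun_prop

@[fun_prop]
lemma measurable_w (τ : Equiv.Perm (Fin (k + 1))) : Measurable (w τ) := by
  unfold w; fun_prop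

lemma measurable_Qker : Measurable (Qker (k := k)) := by
  refine Measure.measurable_of_measurable_coe _ fun s hs => ?_
  simp only [Qker, Measure.finsetSum_apply, Measure.smul_apply, smul_eq_mul]
  refine Finset.measurable_fun_sum _ fun τ _ => Measurable.mul (by fun_prop) ?_
  exact (Measure.measurable_coe hs).comp (Measure.measurable_dirac.comp (by fun_prop))

lemma measurable_Psi (x : Fin k → ℝ) : Measurable fun g => Psi g x := by
  unfold Psi Phi; fun_prop

lemma lintegral_Qker (l : Fin k → ℝ) {f : (Fin k → ℝ) → ENNReal} (hf : Measurable f) :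
    ∫⁻ m, f m ∂Qker l =
      ∑ τ : Equiv.Perm (Fin (k + 1)), ENNReal.ofReal (w τ l) * f fun i => F τ i l := by
  simp [Qker, lintegral_finsetSum_measure, lintegral_smul_measure, lintegral_dirac' _ hf]

lemma mul_exp_neg_mul_le_inv {c t : ℝ} (ht : 0 < t) :
    c * Real.exp (-(c * t)) ≤ t⁻¹ := by
  have h := Real.mul_exp_neg_le_exp_neg_one (c * t)
  have h1 : Real.exp (-1) ≤ 1 := Real.exp_le_one_iff.2 (by norm_num)
  rw [← mul_le_mul_iff_left₀ ht, inv_mul_cancel₀ ht.ne']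
  linarith

lemma ofReal_fmix {ν : Measure (Fin k → ℝ)} [IsProbabilityMeasure ν]
    (hν : ∀ᵐ l ∂ν, ∀ i, 0 < l i) {g : Fin k → ℝ} (hg : ∀ i, 0 < g i) :
    ENNReal.ofReal (fmix ν g) =
      ∫⁻ l, ENNReal.ofReal (∏ i : Fin k, l i * Real.exp (-(l i * g i))) ∂ν := by
  refine ofReal_integral_eq_lintegral_ofReal ?_ ?_
  · refine Integrable.of_bound (C := ∏ i, (g i)⁻¹) (by fun_prop) ?_
    filter_upwards [hν] with l hl
    rw [Real.norm_of_nonneg (prod_mul_exp_nonneg hl g)]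
    exact Finset.prod_le_prod (fun i _ => mul_nonneg (hl i).le (Real.exp_nonneg _))
      fun i _ => mul_exp_neg_mul_le_inv (hg i)
  · filter_upwards [hν] with l hl using prod_mul_exp_nonneg hl g

lemma fmix_nonneg {ν : Measure (Fin k → ℝ)} (hν : ∀ᵐ l ∂ν, ∀ i, 0 < l i) (g : Fin k → ℝ) :
    0 ≤ fmix ν g :=
  integral_nonneg_of_ae <| by filter_upwards [hν] with l hl using prod_mul_exp_nonneg hl g

lemma stronglyMeasurable_fmix (ν : Measure (Fin k → ℝ)) [SFinite ν] :
    StronglyMeasurable (fmix ν) := by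
  refine StronglyMeasurable.integral_prod_right' (f := fun p : (Fin k → ℝ) × (Fin k → ℝ) =>
    ∏ i : Fin k, p.2 i * Real.exp (-(p.2 i * p.1 i))) ?_
  exact Measurable.stronglyMeasurable (by fun_prop)

end

/-- if `ν` is an invariant probability measure for `Q` on `(0,∞)^k`,
then `f_ν` is a fixed point of the gaps operator of iterated Brownian motion. -/
theorem stmt10 {k : ℕ} (hk : 1 ≤ k) (ν : Measure (Fin k → ℝ)) [IsProbabilityMeasure ν]
    (hν : ν {l : Fin k → ℝ | ∀ i, 0 < l i} = 1)
    (hfix : ν.bind Qker = ν)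
    (x : Fin k → ℝ) (hx : ∀ i, 0 < x i) :
    ∫ g in {g : Fin k → ℝ | ∀ i, 0 < g i}, fmix ν g * Psi g x = fmix ν x := by
  have hpos : ∀ᵐ l ∂ν, ∀ i, 0 < l i :=
    (mem_ae_iff_prob_eq_one measurableSet_setOf_forall_pos).2 hν
  have hmeas : Measurable fun l : Fin k → ℝ =>
      ENNReal.ofReal (∏ i : Fin k, l i * Real.exp (-(l i * x i))) := by fun_prop
  have hΨ := measurable_Psi x
  have key : ∫⁻ g in {g : Fin k → ℝ | ∀ i, 0 < g i}, ENNReal.ofReal (fmix ν g * Psi g x) =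
      ENNReal.ofReal (fmix ν x) := calc
    _ = ∫⁻ g in {g : Fin k → ℝ | ∀ i, 0 < g i}, ∫⁻ l : Fin k → ℝ,
          ENNReal.ofReal (∏ i : Fin k, l i * Real.exp (-(l i * g i))) *
            ENNReal.ofReal (Psi g x) ∂ν := by
        refine setLIntegral_congr_fun measurableSet_setOf_forall_pos fun g hg => ?_
        rw [ENNReal.ofReal_mul (fmix_nonneg hpos g), ofReal_fmix hpos hg,
          lintegral_mul_const _ (by fun_prop)]
    _ = ∫⁻ l : Fin k → ℝ, (∫⁻ g in {g : Fin k → ℝ | ∀ i, 0 < g i},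
          ENNReal.ofReal (∏ i : Fin k, l i * Real.exp (-(l i * g i))) *
            ENNReal.ofReal (Psi g x)) ∂ν := by
        refine lintegral_lintegral_swap (Measurable.aemeasurable ?_)
        simp only [Function.uncurry_def]
        fun_prop
    _ = ∫⁻ l : Fin k → ℝ, ∫⁻ m : Fin k → ℝ,
          ENNReal.ofReal (∏ i : Fin k, m i * Real.exp (-(m i * x i))) ∂Qker l ∂ν := by
        refine lintegral_congr_ae ?_
        filter_upwards [hpos] with l hl
        rw [lintegral_prod_exp_mul_Psi hx hl, lintegral_Qker l hmeas]
    _ = ENNReal.ofReal (fmix ν x) := by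
        rw [← Measure.lintegral_bind measurable_Qker.aemeasurable hmeas.aemeasurable, hfix,
          ofReal_fmix hpos hx]
  rw [integral_eq_lintegral_of_nonneg_ae
    (Filter.Eventually.of_forall fun g => mul_nonneg (fmix_nonneg hpos g) (Psi_nonneg g x))
    ((stronglyMeasurable_fmix ν).measurable.mul hΨ).aestronglyMeasurable, key,
    ENNReal.toReal_ofReal (fmix_nonneg hpos x)]
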